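/- arXiv:0910.2082 — 4 statements merged into one kernel-verified Lean document; each statement's English description precedes it below -/
import Mathlib

section
/- Let ζ_1,ζ_2,ζ_3,ζ_4 be n×n complex matrices with ζ_p − ζ_q invertible for all p ≠ q, and suppose vectors dφ_{pqr} ∈ ℂ^n are given for all ordered triples (p,q,r) of distinct indices from {1,2,3,4}, satisfying: dφ changes sign under odd permutations of (p,q,r); dφ_{pqr} + dφ_{qrp} + dφ_{rpq} = 0; and ζ_p dφ_{pqr} + ζ_q dφ_{qrp} + ζ_r dφ_{rpq} = 0. For each vertex v define dψ_v := dφ_{vpq} + dφ_{vqr} + dφ_{vrp}, where (v,p,q,r) is an even permutation of (1,2,3,4) (this is independent of the choice of such permutation). Then dψ_1 + dψ_2 + dψ_3 + dψ_4 = 0 and ζ_1 dψ_1 + ζ_2 dψ_2 + ζ_3 dψ_3 + ζ_4 dψ_4 = 0. -/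
open Matrix

/-- Let `ζ` be `n×n` matrix coordinates at the four vertices of a tetrahedron (here
`Fin 4`), with all pairwise differences invertible, and let `dφ_{pqr} ∈ ℂⁿ` (given for
all ordered triples of distinct vertices) satisfy: `dφ` changes sign under odd
permutations of the face, i.e. `dφ_{prq} = −dφ_{pqr}` (each odd ordering of a face
carries minus the value of the even ordering with the same distinguished first vertex);
`dφ_{pqr} + dφ_{qrp} + dφ_{rpq} = 0`; and
`ζ_p dφ_{pqr} + ζ_q dφ_{qrp} + ζ_r dφ_{rpq} = 0`.  Suppose `dψ_v` is given for each
vertex `v` by `dψ_v = dφ_{vpq} + dφ_{vqr} + dφ_{vrp}` whenever `(v,p,q,r)` is an even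
permutation of `(1,2,3,4)` (this prescription is independent of the choice of such a
permutation).  Then `dψ_1 + dψ_2 + dψ_3 + dψ_4 = 0` and
`ζ_1 dψ_1 + ζ_2 dψ_2 + ζ_3 dψ_3 + ζ_4 dψ_4 = 0`. -/
theorem tetra_differential_relations (n : ℕ) (ζ : Fin 4 → Matrix (Fin n) (Fin n) ℂ)
    (hζ : ∀ p q : Fin 4, p ≠ q → IsUnit (ζ p - ζ q))
    (dφ : Fin 4 → Fin 4 → Fin 4 → (Fin n → ℂ))
    (hodd : ∀ p q r : Fin 4, p ≠ q → p ≠ r → q ≠ r → dφ p r q = -dφ p q r)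
    (hsum : ∀ p q r : Fin 4, p ≠ q → p ≠ r → q ≠ r →
      dφ p q r + dφ q r p + dφ r p q = 0)
    (hζsum : ∀ p q r : Fin 4, p ≠ q → p ≠ r → q ≠ r →
      ζ p *ᵥ dφ p q r + ζ q *ᵥ dφ q r p + ζ r *ᵥ dφ r p q = 0)
    (dψ : Fin 4 → (Fin n → ℂ))
    (hdψ : ∀ σ : Equiv.Perm (Fin 4), Equiv.Perm.sign σ = 1 →
      dψ (σ 0) = dφ (σ 0) (σ 1) (σ 2) + dφ (σ 0) (σ 2) (σ 3) + dφ (σ 0) (σ 3) (σ 1)) :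
    dψ 0 + dψ 1 + dψ 2 + dψ 3 = 0
      ∧ ζ 0 *ᵥ dψ 0 + ζ 1 *ᵥ dψ 1 + ζ 2 *ᵥ dψ 2 + ζ 3 *ᵥ dψ 3 = 0 := by
  have h0 : dψ 0 = dφ 0 1 2 + dφ 0 2 3 + dφ 0 3 1 := hdψ 1 (by decide)
  have h1 : dψ 1 = dφ 1 0 3 + dφ 1 3 2 + dφ 1 2 0 :=
    hdψ (Equiv.swap 0 1 * Equiv.swap 2 3) (by decide)
  have h2 : dψ 2 = dφ 2 3 0 + dφ 2 0 1 + dφ 2 1 3 :=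
    hdψ (Equiv.swap 0 2 * Equiv.swap 1 3) (by decide)
  have h3 : dψ 3 = dφ 3 2 1 + dφ 3 1 0 + dφ 3 0 2 :=
    hdψ (Equiv.swap 0 3 * Equiv.swap 1 2) (by decide)
  rw [h0, h1, h2, h3]
  -- Each `dφ` term lies on exactly one of the four positively oriented faces.
  constructor
  · linear_combination hsum 0 1 2 (by decide) (by decide) (by decide) +
      hsum 0 2 3 (by decide) (by decide) (by decide) +
      hsum 0 3 1 (by decide) (by decide) (by decide) +
      hsum 1 3 2 (by decide) (by decide) (by decide)
  · simp only [mulVec_add]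
    linear_combination hζsum 0 1 2 (by decide) (by decide) (by decide) +
      hζsum 0 2 3 (by decide) (by decide) (by decide) +
      hζsum 0 3 1 (by decide) (by decide) (by decide) +
      hζsum 1 3 2 (by decide) (by decide) (by decide)
end

section
/- Let ζ_i,ζ_j,ζ_k and z_i,z_j,z_k be n×n complex matrices such that all pairwise differences ζ_p − ζ_q and z_p − z_q (p ≠ q) are invertible, and for any ordered triple (p,q,r) of distinct indices from {i,j,k} set φ_{pqr} := (ζ_p − ζ_q)^{-1}(z_p − z_q)(z_p − z_r)^{-1}(ζ_p − ζ_r). Then: (i) φ_{ikj} = φ_{ijk}^{-1}; (ii) ζ_{ij}^{-1} ζ_{ik} − φ_{ijk} = −ζ_{ji}^{-1} ζ_{jk} φ_{kij}^{-1}, where ζ_{pq} := ζ_p − ζ_q. -/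
/-- The matrix attached by the map `F₂` to the ordered face `(p,q,r)`:
`φ_{pqr} := (ζ_p − ζ_q)⁻¹ (z_p − z_q)(z_p − z_r)⁻¹ (ζ_p − ζ_r)`. -/
noncomputable def phi {n : ℕ} {ι : Type} (ζ z : ι → Matrix (Fin n) (Fin n) ℂ)
    (p q r : ι) : Matrix (Fin n) (Fin n) ℂ :=
  (ζ p - ζ q)⁻¹ * (z p - z q) * (z p - z r)⁻¹ * (ζ p - ζ r)

theorem matrix_inv_neg {m R : Type*} [Fintype m] [DecidableEq m] [CommRing R]
    {A : Matrix m m R} (hA : IsUnit A.det) : (-A)⁻¹ = -A⁻¹ :=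
  Matrix.inv_eq_left_inv (by rw [neg_mul_neg, Matrix.nonsing_inv_mul _ hA])

/-- Exchanging the last two vertices of a face inverts its matrix. -/
theorem phi_inv {n : ℕ} {ι : Type} {ζ z : ι → Matrix (Fin n) (Fin n) ℂ} {p q r : ι}
    (hζ : IsUnit (ζ p - ζ q)) (hz : IsUnit (z p - z r)) :
    (phi ζ z p q r)⁻¹ = phi ζ z p r q := by
  rw [Matrix.isUnit_iff_isUnit_det] at hζ hz
  simp only [phi, Matrix.mul_inv_rev, Matrix.nonsing_inv_nonsing_inv _ hζ,
    Matrix.nonsing_inv_nonsing_inv _ hz, mul_assoc]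

/-- The permutation rules for the face matrices `φ`: for three vertices `i,j,k`
(here `0,1,2 : Fin 3`) with `n×n` matrix coordinates `ζ` and matrices `z`, all pairwise
differences being invertible,
(i) `φ_{ikj} = φ_{ijk}⁻¹`;
(ii) `ζ_{ij}⁻¹ ζ_{ik} − φ_{ijk} = −ζ_{ji}⁻¹ ζ_{jk} φ_{kij}⁻¹`. -/
theorem phi_permutation_rules (n : ℕ) (ζ z : Fin 3 → Matrix (Fin n) (Fin n) ℂ)
    (hζ : ∀ p q : Fin 3, p ≠ q → IsUnit (ζ p - ζ q))
    (hz : ∀ p q : Fin 3, p ≠ q → IsUnit (z p - z q)) :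
    phi ζ z 0 2 1 = (phi ζ z 0 1 2)⁻¹
      ∧ (ζ 0 - ζ 1)⁻¹ * (ζ 0 - ζ 2) - phi ζ z 0 1 2
          = -((ζ 1 - ζ 0)⁻¹ * (ζ 1 - ζ 2) * (phi ζ z 2 0 1)⁻¹) := by
  refine ⟨(phi_inv (hζ 0 1 (by decide)) (hz 0 2 (by decide))).symm, ?_⟩
  rw [phi_inv (hζ 2 0 (by decide)) (hz 2 1 (by decide))]
  have hζ₀₁ := (Matrix.isUnit_iff_isUnit_det _).mp (hζ 0 1 (by decide))
  have hζ₁₂ := (Matrix.isUnit_iff_isUnit_det _).mp (hζ 1 2 (by decide))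
  have hz₀₂ := (Matrix.isUnit_iff_isUnit_det _).mp (hz 0 2 (by decide))
  have hz_sub : 1 - (z 0 - z 1) * (z 0 - z 2)⁻¹ = (z 1 - z 2) * (z 0 - z 2)⁻¹ := by
    rw [← Matrix.mul_nonsing_inv _ hz₀₂, ← sub_mul]
    congr 1
    abel
  calc (ζ 0 - ζ 1)⁻¹ * (ζ 0 - ζ 2) - phi ζ z 0 1 2
      = (ζ 0 - ζ 1)⁻¹ * (1 - (z 0 - z 1) * (z 0 - z 2)⁻¹) * (ζ 0 - ζ 2) := by
        rw [phi]; noncomm_ring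
    _ = (ζ 0 - ζ 1)⁻¹ * ((ζ 1 - ζ 2) * (ζ 1 - ζ 2)⁻¹) * (z 1 - z 2) * (z 0 - z 2)⁻¹
          * (ζ 0 - ζ 2) := by
        rw [hz_sub, Matrix.mul_nonsing_inv _ hζ₁₂, mul_one, ← mul_assoc]
    _ = -((ζ 1 - ζ 0)⁻¹ * (ζ 1 - ζ 2) * phi ζ z 2 1 0) := by
        rw [phi, ← neg_sub (ζ 0) (ζ 1), ← neg_sub (ζ 1) (ζ 2), ← neg_sub (z 1) (z 2),
          ← neg_sub (z 0) (z 2), ← neg_sub (ζ 0) (ζ 2)]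
        simp only [matrix_inv_neg hζ₀₁, matrix_inv_neg hζ₁₂, matrix_inv_neg hz₀₂, neg_mul, mul_neg,
          neg_neg, mul_assoc]
end

section
/- Let A be an r×m complex matrix with r ≤ m and let ℐ be a subset of its columns with |ℐ| ≤ r. Then the multiple Berezin integral of the generating function f_A over the generators a_l with l ∈ ℐ equals the generating function of A with inner column set ℐ: ∫⋯∫ f_A Π_{l∈ℐ} da_l = Σ_{𝒞 ⊇ ℐ} det′(A|_𝒞) Π_{k∈𝒞∖ℐ} a_k, where 𝒞 runs over r-element column subsets containing ℐ, and the differentials da_l are taken in increasing order of l. -/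
/-!
A concrete model of the Grassmann algebra over `ℂ` with generators indexed by a
linearly ordered type `ι`: an element is its coefficient function on the basis of
monomials `a_{i₁} ⋯ a_{i_k}` (`i₁ < ⋯ < i_k`), identified with `Finset ι`.
-/

namespace Grassmann

variable {ι : Type} [LinearOrder ι]

/-- An element of the Grassmann algebra, as the coefficient function on basis monomials. -/
abbrev G (ι : Type) : Type := Finset ι → ℂ

/-- The product in the Grassmann algebra (shuffle product with signs). -/
noncomputable def gmul (f g : G ι) : G ι := fun U =>
  ∑ S ∈ U.powerset,
    ((-1 : ℂ) ^ (((S ×ˢ (U \ S)).filter fun p => p.2 < p.1).card)) * f S * g (U \ S)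

/-- The unit of the Grassmann algebra. -/
def gone : G ι := fun S => if S = ∅ then 1 else 0

/-- The generator `a_i` of the Grassmann algebra. -/
def gen (i : ι) : G ι := fun S => if S = {i} then 1 else 0

/-- The ordered product `a_{l₁} a_{l₂} ⋯ a_{l_k}` of the generators listed in `l`. -/
noncomputable def genProdL : List ι → G ι :=
  fun l => l.foldr (fun i acc => gmul (gen i) acc) gone

/-- The Berezin integral `∫ f da_i`, characterized by `∫ da_i = 0`, `∫ a_i da_i = 1` and
`∫ g h da_i = g ∫ h da_i` for `g` not containing `a_i` (the "right derivative" in `a_i`). -/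
noncomputable def berezin (i : ι) (f : G ι) : G ι := fun T =>
  if i ∈ T then 0 else (-1 : ℂ) ^ ((T.filter fun j => i < j).card) * f (insert i T)

/-- The iterated Berezin integral `∫⋯∫ f da_{l₁} ⋯ da_{l_k}` over the differentials
listed in `l` (iterated multiple integral, with the convention
`∫∫ f(a) g(b) da db = (∫ f da) (∫ g db)`). -/
noncomputable def multiBerezin : List ι → G ι → G ι :=
  fun l f => l.foldr berezin f

end Grassmann

open Grassmann

/-- The determinant of the maximal square submatrix of the `r × m` matrix `A` on the
columns listed in `cols` (in the listed order). -/
noncomputable def detColumns {r m : ℕ} (A : Matrix (Fin r) (Fin m) ℂ)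
    (cols : List (Fin m)) : ℂ :=
  (Matrix.of fun i j : Fin r =>
    if hj : (j : ℕ) < cols.length then A i (cols.get ⟨j, hj⟩) else 0).det

/-- The generating function `𝐟_A := Σ_𝒞 det (A|_𝒞) Π_{k ∈ 𝒞} a_k` of an `r × m` complex
matrix `A`, the sum being over all `r`-element subsets `𝒞` of the set of columns, `A|_𝒞`
the square submatrix of `A` on the columns in `𝒞` (in increasing order), and the
generators `a_k`, `k ∈ 𝒞`, multiplied in increasing order of the column index `k`. -/
noncomputable def genFun {r m : ℕ} (A : Matrix (Fin r) (Fin m) ℂ) : G (Fin m) :=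
  ∑ C : Finset (Fin m),
    (if C.card = r then detColumns A (C.sort (· ≤ ·)) else 0) •
      genProdL (C.sort (· ≤ ·))

/-- The generating function `ℐ𝐟_A := Σ_{𝒞 ⊇ ℐ} det′ (A|_𝒞) Π_{k ∈ 𝒞 ∖ ℐ} a_k` of the
matrix `A` with set `ℐ` of inner columns: `det′` is the determinant of the square
submatrix on the columns `𝒞` after moving all the inner columns to the right (keeping
the relative order within `ℐ` and within its complement), and the generators
`a_k`, `k ∈ 𝒞 ∖ ℐ`, are multiplied in increasing order of the column index. -/
noncomputable def genFunInner {r m : ℕ} (A : Matrix (Fin r) (Fin m) ℂ)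
    (I : Finset (Fin m)) : G (Fin m) :=
  ∑ C : Finset (Fin m),
    (if I ⊆ C ∧ C.card = r then
        detColumns A ((C \ I).sort (· ≤ ·) ++ I.sort (· ≤ ·)) else 0) •
      genProdL ((C \ I).sort (· ≤ ·))

namespace Grassmann

variable {ι : Type} [LinearOrder ι]

/-- An increasing product of generators is the corresponding basis monomial. -/
theorem genProdL_apply_of_pairwise_lt {l : List ι} (hl : l.Pairwise (· < ·)) (U : Finset ι) :
    genProdL l U = if U = l.toFinset then 1 else 0 := by
  induction l generalizing U with
  | nil => rfl
  | cons i l ih =>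
    obtain ⟨hi, hl⟩ := List.pairwise_cons.1 hl
    have hil : i ∉ l := fun h => lt_irrefl _ (hi i h)
    change gmul (gen i) (genProdL l) U = _
    simp only [gmul, ih hl, gen]
    by_cases hU : U = (i :: l).toFinset
    · subst hU
      have hsd : (i :: l).toFinset \ {i} = l.toFinset := by
        ext x
        simp only [Finset.mem_sdiff, List.mem_toFinset, List.mem_cons, Finset.mem_singleton]
        grind
      rw [Finset.sum_eq_single {i}]
      · rw [hsd, Finset.card_eq_zero.2]
        · simp
        · rw [Finset.filter_eq_empty_iff]
          rintro ⟨a, b⟩ hab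
          simp only [Finset.mem_product, Finset.mem_singleton, List.mem_toFinset] at hab
          simpa [hab.1] using (hi b hab.2).le
      · intro S _ hS
        simp [hS]
      · intro h
        simp at h
    · rw [if_neg hU]
      refine Finset.sum_eq_zero fun S hS => ?_
      by_cases h1 : S = {i}
      · rw [if_neg (c := U \ S = _), mul_zero]
        rintro h
        apply hU
        rw [List.toFinset_cons, ← h, h1]
        have : i ∈ U := by simpa [h1] using hS
        ext x
        simp only [Finset.mem_insert, Finset.mem_sdiff, Finset.mem_singleton]
        grind
      · simp [h1]

theorem genProdL_sort (C : Finset ι) :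
    genProdL (C.sort (· ≤ ·)) = Pi.single C 1 := by
  funext U
  rw [genProdL_apply_of_pairwise_lt (Finset.sortedLT_sort C).pairwise, Finset.sort_toFinset,
    Pi.single_apply]

theorem sort_eq_filter_append (T : Finset ι) {i : ι} (hi : i ∉ T) :
    T.sort (· ≤ ·) =
      (T.filter (· < i)).sort (· ≤ ·) ++ (T.filter (i < ·)).sort (· ≤ ·) := by
  refine List.Perm.eq_of_pairwise' (r := (· ≤ ·)) (Finset.pairwise_sort _ _) ?_ ?_
  · rw [List.pairwise_append]
    refine ⟨Finset.pairwise_sort _ _, Finset.pairwise_sort _ _, fun a ha b hb => ?_⟩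
    simp only [Finset.mem_sort, Finset.mem_filter] at ha hb
    exact (ha.2.trans hb.2).le
  · refine (List.perm_ext_iff_of_nodup (Finset.sort_nodup _ _) ?_).2 fun a => ?_
    · rw [List.nodup_append]
      refine ⟨Finset.sort_nodup _ _, Finset.sort_nodup _ _, fun a ha b hb => ?_⟩
      simp only [Finset.mem_sort, Finset.mem_filter] at ha hb
      exact (ha.2.trans hb.2).ne
    · simp only [Finset.mem_sort, Finset.mem_filter, List.mem_append]
      grind

theorem sort_insert_eq_filter_append (T : Finset ι) {i : ι} (hi : i ∉ T) :
    (insert i T).sort (· ≤ ·) =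
      (T.filter (· < i)).sort (· ≤ ·) ++ i :: (T.filter (i < ·)).sort (· ≤ ·) := by
  refine List.Perm.eq_of_pairwise' (r := (· ≤ ·)) (Finset.pairwise_sort _ _) ?_ ?_
  · rw [List.pairwise_append, List.pairwise_cons]
    refine ⟨Finset.pairwise_sort _ _, ⟨fun b hb => ?_, Finset.pairwise_sort _ _⟩,
      fun a ha b hb => ?_⟩
    · simp only [Finset.mem_sort, Finset.mem_filter] at hb
      exact hb.2.le
    · simp only [Finset.mem_sort, Finset.mem_filter, List.mem_cons] at ha hb
      rcases hb with rfl | hb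
      · exact ha.2.le
      · exact (ha.2.trans hb.2).le
  · refine ((Finset.sort_perm_toList _ _).trans (Finset.toList_insert hi)).trans ?_
    refine ((Finset.sort_perm_toList T (· ≤ ·)).symm.cons i).trans ?_
    rw [sort_eq_filter_append T hi]
    exact List.perm_middle.symm

end Grassmann

theorem detColumns_append_swap {r m : ℕ} (A : Matrix (Fin r) (Fin m) ℂ)
    (P l : List (Fin m)) (a b : Fin m) (hr : (P ++ a :: b :: l).length = r) :
    detColumns A (P ++ a :: b :: l) = -detColumns A (P ++ b :: a :: l) := by
  have hlen : P.length + (l.length + 2) = r := by simpa using hr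
  let p : Fin r := ⟨P.length, by omega⟩
  let q : Fin r := ⟨P.length + 1, by omega⟩
  have hpq : p ≠ q := by simp [p, q, Fin.ext_iff]
  have key := Matrix.det_permute' (Equiv.swap p q)
    (Matrix.of fun i j : Fin r => if hj : (j : ℕ) < (P ++ b :: a :: l).length then
      A i ((P ++ b :: a :: l).get ⟨j, hj⟩) else 0)
  rw [Equiv.Perm.sign_swap hpq] at key
  simp only [Units.val_neg, Units.val_one, Int.cast_neg, Int.cast_one, neg_mul, one_mul] at key
  unfold detColumns
  rw [← key]
  congr 1
  ext i j
  have hj := j.2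
  have h1 : (j : ℕ) < (P ++ a :: b :: l).length := by omega
  have h2 : ∀ k : Fin r, (k : ℕ) < (P ++ b :: a :: l).length := fun k => by
    have := k.2
    simp only [List.length_append, List.length_cons]
    omega
  simp only [Matrix.of_apply, Matrix.submatrix_apply, id, dif_pos h1, dif_pos (h2 _),
    List.get_eq_getElem]
  congr 1
  by_cases hp : j = p
  · subst hp
    simp [p, q]
  by_cases hq : j = q
  · subst hq
    simp [p, q]
  simp only [Equiv.swap_apply_of_ne_of_ne hp hq]
  have hp' : (j : ℕ) ≠ P.length := fun h => hp (Fin.ext h)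
  have hq' : (j : ℕ) ≠ P.length + 1 := fun h => hq (Fin.ext h)
  rcases lt_or_ge (j : ℕ) P.length with h | h
  · rw [List.getElem_append_left h, List.getElem_append_left h]
  · obtain ⟨k, hk⟩ : ∃ k, (j : ℕ) = P.length + (k + 2) := ⟨j - P.length - 2, by omega⟩
    simp [hk, List.getElem_append_right]

theorem detColumns_append_move {r m : ℕ} (A : Matrix (Fin r) (Fin m) ℂ)
    (P Q l : List (Fin m)) (a : Fin m) (hr : (P ++ Q ++ a :: l).length = r) :
    detColumns A (P ++ Q ++ a :: l) = (-1) ^ Q.length * detColumns A (P ++ a :: Q ++ l) := by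
  induction Q generalizing P with
  | nil => simp
  | cons b Q ih =>
    have := ih (P ++ [b]) (by simpa [add_assoc, add_comm, add_left_comm] using hr)
    have hswap := detColumns_append_swap A P (Q ++ l) b a
      (by simp only [List.length_append, List.length_cons] at hr ⊢; omega)
    simp only [List.append_assoc, List.cons_append, List.nil_append] at this hswap ⊢
    rw [this, hswap, List.length_cons]
    ring

theorem genFun_apply {r m : ℕ} (A : Matrix (Fin r) (Fin m) ℂ) (S : Finset (Fin m)) :
    genFun A S = if S.card = r then detColumns A (S.sort (· ≤ ·)) else 0 := by
  simp only [genFun, genProdL_sort, Finset.sum_apply, Pi.smul_apply, Pi.single_apply,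
    smul_eq_mul, mul_ite, mul_one, mul_zero]
  simp

theorem genFunInner_apply {r m : ℕ} (A : Matrix (Fin r) (Fin m) ℂ)
    (I T : Finset (Fin m)) :
    genFunInner A I T = if Disjoint T I ∧ T.card + I.card = r then
      detColumns A (T.sort (· ≤ ·) ++ I.sort (· ≤ ·)) else 0 := by
  simp only [genFunInner, genProdL_sort, Finset.sum_apply, Pi.smul_apply, Pi.single_apply,
    smul_eq_mul, mul_ite, mul_one, mul_zero]
  by_cases hd : Disjoint T I
  · rw [Finset.sum_eq_single (T ∪ I)]
    · simp [Finset.union_sdiff_cancel_right hd, Finset.card_union_of_disjoint hd, hd]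
    · intro C _ hC
      split_ifs with h1 h2 <;> try rfl
      exact absurd (by rw [h1, Finset.sdiff_union_of_subset h2.1]) hC
    · simp
  · rw [if_neg fun h => hd h.1]
    refine Finset.sum_eq_zero fun C _ => if_neg ?_
    rintro rfl
    exact hd Finset.sdiff_disjoint

theorem multiBerezin_genFun_apply {r m : ℕ} (A : Matrix (Fin r) (Fin m) ℂ)
    {l : List (Fin m)} (hl : l.Nodup) (T : Finset (Fin m)) :
    multiBerezin l (genFun A) T = if Disjoint T l.toFinset ∧ T.card + l.length = r then
      detColumns A (T.sort (· ≤ ·) ++ l) else 0 := by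
  induction l generalizing T with
  | nil => simp [multiBerezin, genFun_apply]
  | cons i l ih =>
    obtain ⟨hil, hl⟩ := List.nodup_cons.1 hl
    change berezin i (multiBerezin l (genFun A)) T = _
    simp only [berezin, ih hl]
    by_cases hi : i ∈ T
    · simp [hi]
    · have hcond : (Disjoint (insert i T) l.toFinset ∧ (insert i T).card + l.length = r) ↔
          (Disjoint T (i :: l).toFinset ∧ T.card + (i :: l).length = r) := by
        simp only [Finset.disjoint_insert_left, List.toFinset_cons, Finset.disjoint_insert_right,
          Finset.card_insert_of_notMem hi, List.mem_toFinset, List.length_cons, hil, hi,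
          not_false_eq_true, true_and, add_assoc, add_comm 1]
      rw [if_neg hi, if_congr hcond rfl rfl]
      split_ifs with h
      · rw [sort_insert_eq_filter_append T hi, sort_eq_filter_append T hi,
          detColumns_append_move, Finset.length_sort]
        rw [← sort_eq_filter_append T hi]
        simpa using h.2
      · simp

/-- **Lemma 2 of the paper**: the multiple Berezin integral of the generating function
`𝐟_A` of an `r × m` matrix `A` (with `r ≤ m`) over the generators `a_l`, `l ∈ ℐ`
(`|ℐ| ≤ r`, differentials taken in increasing order of `l`), equals the generating
function of `A` with the set `ℐ` of inner columns. -/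
theorem multiBerezin_genFun {r m : ℕ} (hrm : r ≤ m) (A : Matrix (Fin r) (Fin m) ℂ)
    (I : Finset (Fin m)) (hI : I.card ≤ r) :
    multiBerezin (I.sort (· ≤ ·)) (genFun A) = genFunInner A I := by
  funext T
  rw [multiBerezin_genFun_apply A (Finset.sort_nodup _ _), genFunInner_apply,
    Finset.sort_toFinset, Finset.length_sort]
end

section
/- Let ζ_1,…,ζ_5 be n×n complex matrices such that ζ_i − ζ_j is invertible for all i ≠ j, and for each three-element subset {i,j,k} of {1,…,5} (written with i<j<k) let a_{ijk} be a vector of n anticommuting Grassmann generators. Then the matrix tetrahedron weights satisfy the pentagon equation: (det ζ_{23} / (det ζ_{34} · det ζ_{35})) · ∫⋯∫ f_{1234} f_{1235} 𝒟a_{123} = (1/det ζ_{45}) · ∫⋯∫ f_{1245} f_{2345} f_{1345} 𝒟a_{145} 𝒟a_{245} 𝒟a_{345}, where the left integral is n-fold, the right integral is 3n-fold, and 𝒟a_{ijk} denotes the product of the n differentials of the components of a_{ijk} taken in their natural order. -/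
open Grassmann

/-- A `b·n × c·n` matrix assembled from `n × n` blocks. -/
def ofBlocks {b c n : ℕ} (B : Fin b → Fin c → Matrix (Fin n) (Fin n) ℂ) :
    Matrix (Fin (b * n)) (Fin (c * n)) ℂ :=
  Matrix.of fun i j =>
    B ⟨(i : ℕ) / n, by
        rcases Nat.eq_zero_or_pos n with h | h
        · exact absurd i.isLt (by simp [h])
        · exact (Nat.div_lt_iff_lt_mul h).2 i.isLt⟩
      ⟨(j : ℕ) / n, by
        rcases Nat.eq_zero_or_pos n with h | h
        · exact absurd j.isLt (by simp [h])
        · exact (Nat.div_lt_iff_lt_mul h).2 j.isLt⟩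
      ⟨(i : ℕ) % n, Nat.mod_lt _ (by
        rcases Nat.eq_zero_or_pos n with h | h
        · exact absurd i.isLt (by simp [h])
        · exact h)⟩
      ⟨(j : ℕ) % n, Nat.mod_lt _ (by
        rcases Nat.eq_zero_or_pos n with h | h
        · exact absurd j.isLt (by simp [h])
        · exact h)⟩

/-- The index type for the `10 n` Grassmann generators: the component `c` of the vector
`a_{ijk}` of `n` generators attached to the face `{i,j,k} ⊂ {1,…,5}`, `i < j < k`;
ordered by the face (lexicographically) first, then by the component. -/
abbrev FaceComp (n : ℕ) : Type := (Fin 5 ×ₗ Fin 5 ×ₗ Fin 5) ×ₗ Fin n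

/-- The generator index of component `c` of the generator vector `a_{ijk}`. -/
def fc {n : ℕ} (i j k : Fin 5) (c : Fin n) : FaceComp n :=
  toLex (toLex (i, toLex (j, k)), c)

/-- The list of the `n` generator indices of `a_{ijk}` in their natural order:
the differential `𝒟a_{ijk}`. -/
def Da (n : ℕ) (i j k : Fin 5) : List (FaceComp n) :=
  (List.finRange n).map (fc i j k)

/-- The generating function `𝐟_A := Σ_𝒞 det (A|_𝒞) Π_{k ∈ 𝒞} a_{col k}` of an `r × m`
complex matrix `A` whose column `k` carries the Grassmann generator `a_{col k}`; the sum
is over all `r`-element subsets `𝒞` of the set of columns and the generators are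
multiplied in the order of the columns. -/
noncomputable def genFunL {ι : Type} [LinearOrder ι] {r m : ℕ}
    (A : Matrix (Fin r) (Fin m) ℂ) (col : Fin m → ι) : G ι :=
  ∑ C : Finset (Fin m),
    (if C.card = r then detColumns A (C.sort (· ≤ ·)) else 0) •
      genProdL ((C.sort (· ≤ ·)).map col)

/-- The `2 × 4` block structure (`n × n` blocks) of the matrix `f₃^full` of one
tetrahedron `i₁i₂i₃i₄` (`i₁ < i₂ < i₃ < i₄`), formula (19) of the paper:
`[[1, −1, 1, 0], [ζ_{i₂i₃}⁻¹ ζ_{i₃i₁}, −ζ_{i₂i₄}⁻¹ ζ_{i₄i₁}, 0, −1]]`. -/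
noncomputable def tetraBlocks {n : ℕ} (ζ : Fin 5 → Matrix (Fin n) (Fin n) ℂ)
    (i₁ i₂ i₃ i₄ : Fin 5) : Fin 2 → Fin 4 → Matrix (Fin n) (Fin n) ℂ :=
  ![![1, -1, 1, 0],
    ![(ζ i₂ - ζ i₃)⁻¹ * (ζ i₃ - ζ i₁), -((ζ i₂ - ζ i₄)⁻¹ * (ζ i₄ - ζ i₁)), 0, -1]]

/-- The four faces of the tetrahedron `i₁i₂i₃i₄`, in the order of the block columns
of `f₃^full`. -/
def tetraFaces (i₁ i₂ i₃ i₄ : Fin 5) : Fin 4 → Fin 5 × Fin 5 × Fin 5 :=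
  ![(i₁, i₂, i₃), (i₁, i₂, i₄), (i₁, i₃, i₄), (i₂, i₃, i₄)]

/-- The generator carried by column `j` of the `2n × 4n` matrix `f₃^full` of the
tetrahedron `i₁i₂i₃i₄`: component `j mod n` of the generator vector of face `j / n`. -/
def tetraCol {n : ℕ} (i₁ i₂ i₃ i₄ : Fin 5) (j : Fin (4 * n)) : FaceComp n :=
  fc (tetraFaces i₁ i₂ i₃ i₄ ⟨(j : ℕ) / n, by
        rcases Nat.eq_zero_or_pos n with h | h
        · exact absurd j.isLt (by simp [h])
        · exact (Nat.div_lt_iff_lt_mul h).2 j.isLt⟩).1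
    (tetraFaces i₁ i₂ i₃ i₄ ⟨(j : ℕ) / n, by
        rcases Nat.eq_zero_or_pos n with h | h
        · exact absurd j.isLt (by simp [h])
        · exact (Nat.div_lt_iff_lt_mul h).2 j.isLt⟩).2.1
    (tetraFaces i₁ i₂ i₃ i₄ ⟨(j : ℕ) / n, by
        rcases Nat.eq_zero_or_pos n with h | h
        · exact absurd j.isLt (by simp [h])
        · exact (Nat.div_lt_iff_lt_mul h).2 j.isLt⟩).2.2
    ⟨(j : ℕ) % n, Nat.mod_lt _ (by
        rcases Nat.eq_zero_or_pos n with h | h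
        · exact absurd j.isLt (by simp [h])
        · exact h)⟩

/-- The weight `𝐟_{i₁i₂i₃i₄}` of a tetrahedron with matrix coordinates: the generating
function of the `2n × 4n` matrix `f₃^full`, whose four block columns carry the generator
vectors `a_{i₁i₂i₃}`, `a_{i₁i₂i₄}`, `a_{i₁i₃i₄}`, `a_{i₂i₃i₄}`. -/
noncomputable def tetraWeight {n : ℕ} (ζ : Fin 5 → Matrix (Fin n) (Fin n) ℂ)
    (i₁ i₂ i₃ i₄ : Fin 5) : G (FaceComp n) :=
  genFunL (ofBlocks (tetraBlocks ζ i₁ i₂ i₃ i₄)) (tetraCol i₁ i₂ i₃ i₄)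

namespace Grassmann

variable {ι : Type} [LinearOrder ι]

/-! ### Products of linear forms -/

/-- Left multiplication by the linear form `∑ i, x i • a_i`. -/
noncomputable def linMul (x : ι → ℂ) (g : G ι) : G ι := fun U =>
  ∑ i ∈ U, (-1 : ℂ) ^ ((U.erase i).filter fun j => j < i).card * x i * g (U.erase i)

/-- The ordered product of the linear forms with the coefficient vectors listed in `L`. -/
noncomputable def linProd (L : List (ι → ℂ)) : G ι := L.foldr linMul gone

theorem card_inversions_eq_sum (S T : Finset ι) :
    ((S ×ˢ T).filter fun p => p.2 < p.1).card = ∑ s ∈ S, (T.filter fun t => t < s).card := by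
  simp only [Finset.card_filter, Finset.sum_product]

theorem gone_gmul (g : G ι) : gmul gone g = g := by
  funext U
  unfold gmul gone
  rw [Finset.sum_eq_single ∅]
  · simp
  · intro S _ hS
    simp [hS]
  · simp

theorem linMul_gmul (x : ι → ℂ) (f g : G ι) :
    gmul (linMul x f) g = linMul x (gmul f g) := by
  funext U
  unfold gmul linMul
  simp only [Finset.mul_sum, Finset.sum_mul]
  rw [Finset.sum_sigma', Finset.sum_sigma']
  refine Finset.sum_bij' (fun p _ => ⟨p.2, p.1.erase p.2⟩) (fun p _ => ⟨insert p.1 p.2, p.1⟩)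
    ?_ ?_ ?_ ?_ ?_
  · rintro ⟨S, i⟩ h
    simp only [Finset.mem_sigma, Finset.mem_powerset] at h ⊢
    exact ⟨h.1 h.2, Finset.erase_subset_erase _ h.1⟩
  · rintro ⟨i, S⟩ h
    simp only [Finset.mem_sigma, Finset.mem_powerset] at h ⊢
    exact ⟨Finset.insert_subset h.1 (h.2.trans (Finset.erase_subset _ _)),
      Finset.mem_insert_self _ _⟩
  · rintro ⟨S, i⟩ h
    simp only [Finset.mem_sigma, Finset.mem_powerset] at h
    simp [Finset.insert_erase h.2]
  · rintro ⟨i, S⟩ h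
    simp only [Finset.mem_sigma, Finset.mem_powerset] at h
    have : i ∉ S := fun hi => by simpa using h.2 hi
    simp [this]
  · rintro ⟨S, i⟩ h
    simp only [Finset.mem_sigma, Finset.mem_powerset] at h
    obtain ⟨hS, hi⟩ := h
    have hdiff : U.erase i \ S.erase i = U \ S := by
      ext j
      simp only [Finset.mem_sdiff, Finset.mem_erase]
      by_cases hj : j = i
      · subst hj; simp [hi]
      · simp [hj]
    have hsplit : ((U.erase i).filter fun j => j < i).card =
        ((S.erase i).filter fun j => j < i).card + ((U \ S).filter fun j => j < i).card := by
      rw [← hdiff, ← Finset.card_union_of_disjoint, ← Finset.filter_union,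
        Finset.union_sdiff_of_subset (Finset.erase_subset_erase _ hS)]
      exact Finset.disjoint_filter_filter Finset.disjoint_sdiff
    simp only [hdiff]
    rw [card_inversions_eq_sum, card_inversions_eq_sum, hsplit, ← Finset.add_sum_erase S _ hi,
      pow_add, pow_add]
    ring_nf

theorem linProd_append (L M : List (ι → ℂ)) :
    linProd (L ++ M) = gmul (linProd L) (linProd M) := by
  induction L with
  | nil => exact (gone_gmul _).symm
  | cons x L ih =>
    change linMul x (linProd (L ++ M)) = gmul (linMul x (linProd L)) _
    rw [ih, linMul_gmul]

/-! ### Coefficients of products of linear forms -/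

/-- The determinant of the values of the row vectors in `L` at the columns listed in `c`,
set to zero when this array is not square. -/
noncomputable def minorDet {κ : Type} (L : List (κ → ℂ)) (c : List κ) : ℂ :=
  if c.length = L.length then
    (Matrix.of fun i j : Fin L.length => (c.map L[i]).getD j 0).det
  else 0

theorem minorDet_of_length_ne {κ : Type} {L : List (κ → ℂ)} {c : List κ} (h : c.length ≠ L.length) :
    minorDet L c = 0 := if_neg h

theorem minorDet_cons {κ : Type} (x : κ → ℂ) (L : List (κ → ℂ)) (c : List κ) :
    minorDet (x :: L) c =
      ∑ k ∈ Finset.range c.length,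
        (-1 : ℂ) ^ k * (c.map x).getD k 0 * minorDet L (c.eraseIdx k) := by
  by_cases h : c.length = L.length + 1
  · rw [minorDet, if_pos (by simpa using h)]
    rw [h, Finset.sum_range]
    refine (Matrix.det_succ_row_zero (n := L.length) _).trans ?_
    refine Finset.sum_congr rfl fun k _ => ?_
    have hk : (k : ℕ) < c.length := by omega
    rw [minorDet, if_pos (by rw [List.length_eraseIdx_of_lt hk]; omega)]
    congr 2
    ext i j
    simp only [Matrix.of_apply, Matrix.submatrix_apply, List.getD_eq_getElem?_getD,
      List.getElem?_map, List.getElem?_eraseIdx]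
    by_cases hjk : (j : ℕ) < k
    · rw [if_pos hjk, Fin.succAbove_of_castSucc_lt _ _ (by simpa [Fin.lt_def] using hjk)]
      simp
    · rw [if_neg hjk, Fin.succAbove_of_le_castSucc _ _ (by simpa [Fin.le_def] using hjk)]
      simp
  · rw [minorDet_of_length_ne (by simpa using h), eq_comm]
    refine Finset.sum_eq_zero fun k hk => ?_
    rw [Finset.mem_range] at hk
    rw [minorDet_of_length_ne, mul_zero]
    rw [List.length_eraseIdx_of_lt hk]
    omega

theorem sort_eq_of_pairwise {T : Finset ι} {l : List ι} (hl : l.Pairwise (· < ·))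
    (hT : ∀ x, x ∈ l ↔ x ∈ T) : T.sort = l := by
  have : T = l.toFinset := by ext x; simp [hT]
  rw [this]
  exact (List.toFinset_sort _ (hl.imp ne_of_lt)).2 (hl.imp le_of_lt)

theorem sort_eq_append_of_notMem {i : ι} {T : Finset ι} (hi : i ∉ T) :
    T.sort = (T.filter fun j => j < i).sort ++ (T.filter fun j => i < j).sort := by
  refine sort_eq_of_pairwise ?_ fun x => ?_
  · rw [List.pairwise_append]
    refine ⟨(Finset.sortedLT_sort _).pairwise, (Finset.sortedLT_sort _).pairwise, ?_⟩
    intro a ha b hb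
    simp only [Finset.mem_sort, Finset.mem_filter] at ha hb
    exact ha.2.trans hb.2
  · simp only [List.mem_append, Finset.mem_sort, Finset.mem_filter, ← and_or_left]
    refine ⟨And.left, fun hx => ⟨hx, lt_or_gt_of_ne ?_⟩⟩
    rintro rfl
    exact hi hx

theorem sort_insert_eq_append {i : ι} {T : Finset ι} (hi : i ∉ T) :
    (insert i T).sort =
      (T.filter fun j => j < i).sort ++ i :: (T.filter fun j => i < j).sort := by
  refine sort_eq_of_pairwise ?_ fun x => ?_
  · rw [List.pairwise_append, List.pairwise_cons]
    refine ⟨(Finset.sortedLT_sort _).pairwise, ⟨by simp, (Finset.sortedLT_sort _).pairwise⟩, ?_⟩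
    intro a ha b hb
    simp only [Finset.mem_sort, Finset.mem_filter, List.mem_cons] at ha hb
    rcases hb with rfl | hb
    · exact ha.2
    · exact ha.2.trans hb.2
  · simp only [List.mem_append, List.mem_cons, Finset.mem_sort, Finset.mem_filter,
      Finset.mem_insert]
    have := lt_trichotomy x i
    tauto

theorem linProd_apply (L : List (ι → ℂ)) (U : Finset ι) :
    linProd L U = minorDet L U.sort := by
  induction L generalizing U with
  | nil =>
    change gone U = _
    by_cases hU : U = ∅
    · subst hU; simp [gone, minorDet]
    · rw [minorDet_of_length_ne (by simpa using hU)]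
      simp [gone, hU]
  | cons x L ih =>
    change linMul x (linProd L) U = _
    rw [minorDet_cons, linMul]
    have hmem : ∀ i, ∀ _ : i ∈ U,
        ((U.erase i).filter fun j => j < i).card ∈ Finset.range U.sort.length := by
      intro i hi
      rw [Finset.mem_range, Finset.length_sort]
      exact (Finset.card_filter_le _ _).trans_lt (Finset.card_erase_lt_of_mem hi)
    have hinj : ∀ i, ∀ _ : i ∈ U, ∀ j, ∀ _ : j ∈ U, ((U.erase i).filter fun k => k < i).card =
        ((U.erase j).filter fun k => k < j).card → i = j := by
      intro i hi j hj hij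
      have key : ∀ a ∈ U, U.sort[((U.erase a).filter fun j => j < a).card]? = some a := by
        intro a ha
        have hs := sort_insert_eq_append (Finset.notMem_erase a U)
        rw [Finset.insert_erase ha] at hs
        rw [hs, List.getElem?_append_right (by simp)]
        simp
      have h1 := key i hi
      rw [hij, key j hj] at h1
      exact (Option.some_injective _ h1).symm
    refine Finset.sum_bij (fun i _ => ((U.erase i).filter fun j => j < i).card) hmem
      (fun i hi j hj => hinj i hi j hj)
      (fun k hk => ?_) ?_
    · obtain ⟨i, hi, h⟩ := Finset.surj_on_of_inj_on_of_card_le _ hmem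
        (fun i j hi hj => hinj i hi j hj) (by simp) k hk
      exact ⟨i, hi, h.symm⟩
    intro i hi
    rw [ih]
    have hs := sort_insert_eq_append (Finset.notMem_erase i U)
    rw [Finset.insert_erase hi] at hs
    have hget : (U.sort.map x).getD ((U.erase i).filter fun j => j < i).card 0 = x i := by
      rw [hs, List.getD_eq_getElem?_getD, List.getElem?_map,
        List.getElem?_append_right (by simp)]
      simp
    have herase : U.sort.eraseIdx ((U.erase i).filter fun j => j < i).card =
        (U.erase i).sort := by
      rw [sort_eq_append_of_notMem (i := i) (T := U.erase i) (by simp), hs,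
        List.eraseIdx_append_of_length_le (by simp)]
      simp
    rw [hget, herase]

theorem minorDet_swap {κ : Type} (L : List (κ → ℂ)) (a b : List κ) (x y : κ) :
    minorDet L (a ++ x :: y :: b) = -minorDet L (a ++ y :: x :: b) := by
  by_cases h : (a ++ x :: y :: b).length = L.length
  · have h' : (a ++ y :: x :: b).length = L.length := by simpa using h
    rw [minorDet, if_pos h, minorDet, if_pos h']
    simp only [List.length_append, List.length_cons] at h
    let p : Fin L.length := ⟨a.length, by omega⟩
    let q : Fin L.length := ⟨a.length + 1, by omega⟩
    have hpq : p ≠ q := by simp [p, q, Fin.ext_iff]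
    have hperm := Matrix.det_permute' (Equiv.swap p q)
      (Matrix.of fun i j : Fin L.length => ((a ++ y :: x :: b).map L[i]).getD j 0)
    rw [Equiv.Perm.sign_swap hpq] at hperm
    simp only [Units.val_neg, Units.val_one, Int.cast_neg, Int.cast_one, neg_mul, one_mul] at hperm
    rw [← hperm]
    congr 1
    ext i j
    simp only [Matrix.of_apply, Matrix.submatrix_apply, id]
    rcases eq_or_ne j p with rfl | hjp
    · rw [Equiv.swap_apply_left]
      simp [p, q]
    · rcases eq_or_ne j q with rfl | hjq
      · rw [Equiv.swap_apply_right]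
        simp [p, q]
      · rw [Equiv.swap_apply_of_ne_of_ne hjp hjq]
        have hp : (j : ℕ) ≠ a.length := fun e => hjp (Fin.ext e)
        have hq : (j : ℕ) ≠ a.length + 1 := fun e => hjq (Fin.ext e)
        simp only [List.getD_eq_getElem?_getD, List.getElem?_map]
        rcases lt_or_ge (j : ℕ) a.length with hj | hj
        · rw [List.getElem?_append_left hj, List.getElem?_append_left hj]
        · rw [List.getElem?_append_right hj, List.getElem?_append_right hj]
          obtain ⟨m, hm⟩ : ∃ m, (j : ℕ) - a.length = m + 2 := ⟨(j : ℕ) - a.length - 2, by omega⟩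
          simp [hm]
  · rw [minorDet_of_length_ne h, minorDet_of_length_ne (by simpa using h), neg_zero]

theorem minorDet_move {κ : Type} (L : List (κ → ℂ)) (a b c : List κ) (x : κ) :
    minorDet L (a ++ x :: (b ++ c)) = (-1) ^ b.length * minorDet L (a ++ b ++ x :: c) := by
  induction b generalizing a with
  | nil => simp
  | cons y b ih =>
    have := ih (a ++ [y])
    simp only [List.append_assoc, List.cons_append, List.nil_append] at this
    simp only [List.cons_append, List.append_assoc, List.length_cons]
    rw [minorDet_swap, this, pow_succ]
    ring

theorem minorDet_eq_zero_of_mem {κ : Type} (L : List (κ → ℂ)) {a c : List κ} {x : κ}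
    (hx : x ∈ a) : minorDet L (a ++ x :: c) = 0 := by
  obtain ⟨a₁, a₂, rfl⟩ := List.append_of_mem hx
  have h := minorDet_move L a₁ a₂ (x :: c) x
  have h' := minorDet_swap L (a₁ ++ a₂) c x x
  have h0 : minorDet L (a₁ ++ a₂ ++ x :: x :: c) = 0 := by
    linear_combination h' / 2
  rw [h0, mul_zero] at h
  simpa using h

theorem minorDet_eq_zero_of_column {κ : Type} (L : List (κ → ℂ)) {c : List κ} {x : κ}
    (hx : x ∈ c) (h0 : ∀ v ∈ L, v x = 0) : minorDet L c = 0 := by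
  unfold minorDet
  split_ifs with h
  · obtain ⟨k, hk, rfl⟩ := List.getElem_of_mem hx
    refine Matrix.det_eq_zero_of_column_eq_zero ⟨k, h ▸ hk⟩ fun i => ?_
    simpa [hk] using h0 _ (List.getElem_mem _)
  · rfl

/-! ### Berezin integration -/

theorem berezin_minorDet (L : List (ι → ℂ)) (l : List ι) (i : ι) :
    berezin i (fun T => minorDet L (T.sort ++ l)) = fun T => minorDet L (T.sort ++ i :: l) := by
  funext T
  unfold berezin
  split_ifs with hi
  · exact (minorDet_eq_zero_of_mem L ((Finset.mem_sort _).2 hi)).symm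
  · beta_reduce
    rw [sort_insert_eq_append hi, sort_eq_append_of_notMem hi, List.append_assoc, List.cons_append,
      minorDet_move, ← mul_assoc, Finset.length_sort, ← mul_pow]
    simp

theorem multiBerezin_linProd (L : List (ι → ℂ)) (l : List ι) (T : Finset ι) :
    multiBerezin l (linProd L) T = minorDet L (T.sort ++ l) := by
  suffices h : multiBerezin l (linProd L) = fun T => minorDet L (T.sort ++ l) from congrFun h T
  induction l with
  | nil =>
    funext T
    rw [List.append_nil]
    exact linProd_apply L T
  | cons i l ih =>
    change berezin i (multiBerezin l (linProd L)) = _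
    rw [ih, berezin_minorDet]

/-! ### Generating functions as products of linear forms -/

theorem gen_gmul_single {i : ι} {S : Finset ι} (h : ∀ j ∈ S, i < j) :
    gmul (gen i) (Pi.single S 1) = Pi.single (insert i S) 1 := by
  have hi : i ∉ S := fun hi => lt_irrefl _ (h i hi)
  funext U
  unfold gmul gen
  by_cases hU : U = insert i S
  · subst hU
    have hd : insert i S \ {i} = S := by
      rw [Finset.sdiff_singleton_eq_erase, Finset.erase_insert hi]
    rw [Finset.sum_eq_single {i}]
    · rw [hd, card_inversions_eq_sum, Finset.sum_singleton,
        Finset.filter_false_of_mem fun j hj => (h j hj).asymm]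
      simp
    · intro V _ hV
      simp [hV]
    · simp
  · rw [Pi.single_eq_of_ne hU]
    refine Finset.sum_eq_zero fun V hV => ?_
    by_cases hVi : V = {i}
    · subst hVi
      rw [Pi.single_eq_of_ne, mul_zero]
      rintro rfl
      rw [Finset.mem_powerset, Finset.singleton_subset_iff] at hV
      exact hU (by rw [Finset.sdiff_singleton_eq_erase, Finset.insert_erase hV])
    · simp [hVi]

theorem genProdL_of_pairwise {l : List ι} (hl : l.Pairwise (· < ·)) :
    genProdL l = Pi.single l.toFinset 1 := by
  induction l with
  | nil =>
    funext U
    simp [genProdL, gone, Pi.single_apply]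
  | cons i l ih =>
    rw [List.pairwise_cons] at hl
    change gmul (gen i) (genProdL l) = _
    rw [ih hl.2, gen_gmul_single (by simpa using hl.1), List.toFinset_cons]

/-- The row `i` of `A`, as the coefficient vector of a linear form in all generators. -/
noncomputable def rowForm {r m : ℕ} (A : Matrix (Fin r) (Fin m) ℂ) (col : Fin m → ι) (i : Fin r) :
    ι → ℂ := fun s => ∑ k, if col k = s then A i k else 0

theorem genFunL_eq_linProd {r m : ℕ} (A : Matrix (Fin r) (Fin m) ℂ) {col : Fin m → ι}
    (hcol : StrictMono col) : genFunL A col = linProd (List.ofFn (rowForm A col)) := by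
  have hsort : ∀ C : Finset (Fin m), C.sort.map col = (C.image col).sort := fun C => by
    refine (sort_eq_of_pairwise ?_ fun x => by simp).symm
    rw [List.pairwise_map]
    exact (Finset.sortedLT_sort C).pairwise.imp fun h => hcol h
  have hprod : ∀ C : Finset (Fin m),
      genProdL (C.sort.map col) = Pi.single (C.image col) 1 := fun C => by
    rw [hsort, genProdL_of_pairwise (Finset.sortedLT_sort _).pairwise, Finset.sort_toFinset]
  have hrow : ∀ i k, rowForm A col i (col k) = A i k := fun i k => by
    simp [rowForm, hcol.injective.eq_iff]
  funext U
  rw [linProd_apply, genFunL, Finset.sum_apply]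
  simp only [hprod, Pi.smul_apply, Pi.single_apply, smul_eq_mul, mul_ite, mul_one, mul_zero]
  by_cases hU : ∃ C : Finset (Fin m), U = C.image col
  · obtain ⟨C, rfl⟩ := hU
    simp only [(Finset.image_injective hcol.injective).eq_iff]
    rw [Finset.sum_ite_eq, if_pos (Finset.mem_univ _), ← hsort, minorDet]
    have hlen : (List.map col C.sort).length = (List.ofFn (rowForm A col)).length ↔
        C.card = r := by simp
    by_cases hC : C.card = r
    · rw [if_pos hC, if_pos (hlen.2 hC), detColumns]
      rw [← Matrix.det_submatrix_equiv_self (finCongr (List.length_ofFn (f := rowForm A col)))]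
      congr 1
      ext i j
      have hj : (j : ℕ) < C.sort.length := by
        have := j.2
        simp only [List.length_ofFn] at this
        simpa [hC] using this
      have hj' : (j : ℕ) < C.card := by simpa using hj
      simp [hj', hrow]
      rfl
    · rw [if_neg hC, if_neg (mt hlen.1 hC)]
  · rw [Finset.sum_eq_zero fun C _ => if_neg fun h => hU ⟨C, h⟩]
    have : ∃ u ∈ U, ∀ k, col k ≠ u := by
      by_contra! h
      refine hU ⟨Finset.univ.filter fun k => col k ∈ U, ?_⟩
      ext u
      simp only [Finset.mem_image, Finset.mem_filter, Finset.mem_univ, true_and]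
      constructor
      · intro hu
        obtain ⟨k, rfl⟩ := h u hu
        exact ⟨k, hu, rfl⟩
      · rintro ⟨k, hk, rfl⟩
        exact hk
    obtain ⟨u, hu, hk⟩ := this
    refine (minorDet_eq_zero_of_column _ ((Finset.mem_sort _).2 hu) fun v hv => ?_).symm
    obtain ⟨i, rfl⟩ := (List.mem_ofFn' _ _).1 hv
    simp [rowForm, hk]

/-! ### Block matrices -/

/-- The determinant of a square matrix of `n × n` blocks. -/
noncomputable def blockDet {κ : Type} [Fintype κ] [DecidableEq κ] {n : ℕ}
    (M : Matrix κ κ (Matrix (Fin n) (Fin n) ℂ)) : ℂ :=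
  (Matrix.comp κ κ (Fin n) (Fin n) ℂ M).det

theorem blockDet_mul {κ : Type} [Fintype κ] [DecidableEq κ] {n : ℕ}
    (M N : Matrix κ κ (Matrix (Fin n) (Fin n) ℂ)) :
    blockDet (M * N) = blockDet M * blockDet N := by
  unfold blockDet
  rw [← Matrix.det_mul]
  exact congrArg Matrix.det (map_mul (Matrix.compRingEquiv κ (Fin n) ℂ) M N)

/-- A matrix of scalar blocks is a Kronecker product with the identity matrix. -/
theorem blockDet_map_scalar {κ : Type} [Fintype κ] [DecidableEq κ] {n : ℕ} (A : Matrix κ κ ℂ) :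
    blockDet (A.map (Matrix.scalar (Fin n))) = A.det ^ n := by
  have h : Matrix.comp κ κ (Fin n) (Fin n) ℂ (A.map (Matrix.scalar (Fin n))) =
      Matrix.kroneckerMap (· * ·) A (1 : Matrix (Fin n) (Fin n) ℂ) := by
    ext ⟨i, k⟩ ⟨j, l⟩
    simp [Matrix.comp_apply, Matrix.diagonal_apply, Matrix.one_apply]
  rw [blockDet, h, Matrix.det_kronecker]
  simp

theorem blockDet_of_upperTriangular {b n : ℕ}
    (M : Matrix (Fin b) (Fin b) (Matrix (Fin n) (Fin n) ℂ))
    (h : ∀ i j, j < i → M i j = 0) : blockDet M = ∏ i, (M i i).det := by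
  have htri : (Matrix.comp _ _ _ _ ℂ M).BlockTriangular Prod.fst := by
    rintro ⟨i, k⟩ ⟨j, l⟩ hij
    simp [Matrix.comp_apply, h i j hij]
  rw [blockDet, htri.det_fintype]
  refine Finset.prod_congr rfl fun i _ => ?_
  let e : Fin n ≃ {a : Fin b × Fin n // a.1 = i} :=
    { toFun := fun k => ⟨(i, k), rfl⟩
      invFun := fun a => a.1.2
      left_inv := fun _ => rfl
      right_inv := by rintro ⟨⟨_, k⟩, rfl⟩; rfl }
  rw [← Matrix.det_submatrix_equiv_self e]
  rfl

theorem blockDet_of_upperRight_eq_zero {a k n : ℕ}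
    (M : Matrix (Fin (a + k)) (Fin (a + k)) (Matrix (Fin n) (Fin n) ℂ))
    (h : ∀ i j, M (Fin.castAdd k i) (Fin.natAdd a j) = 0) :
    blockDet M = blockDet (M.submatrix (Fin.castAdd k) (Fin.castAdd k)) *
      blockDet (M.submatrix (Fin.natAdd a) (Fin.natAdd a)) := by
  let e : (Fin a × Fin n) ⊕ (Fin k × Fin n) ≃ Fin (a + k) × Fin n :=
    (Equiv.sumProdDistrib _ _ _).symm.trans (finSumFinEquiv.prodCongr (Equiv.refl _))
  rw [blockDet, ← Matrix.det_submatrix_equiv_self e, ← Matrix.fromBlocks_toBlocks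
    ((Matrix.comp _ _ _ _ ℂ M).submatrix e e)]
  have h12 : ((Matrix.comp _ _ _ _ ℂ M).submatrix e e).toBlocks₁₂ = 0 := by
    ext ⟨i, c⟩ ⟨j, d⟩
    exact congrFun (congrFun (h i j) c) d
  rw [h12, Matrix.det_fromBlocks_zero₁₂]
  rfl

/-- The block matrix of the values of the block rows `R` at the block columns `γ`. -/
def blockEval {ι : Type} {a b n : ℕ} (R : Fin a → Matrix (Fin n) ι ℂ) (γ : Fin b → Fin n → ι) :
    Matrix (Fin a) (Fin b) (Matrix (Fin n) (Fin n) ℂ) :=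
  Matrix.of fun p q => (R p).submatrix id (γ q)

theorem mul_blockEval {ι : Type} {a b c n : ℕ}
    (P : Matrix (Fin a) (Fin b) (Matrix (Fin n) (Fin n) ℂ))
    (R : Fin b → Matrix (Fin n) ι ℂ) (γ : Fin c → Fin n → ι) :
    P * blockEval R γ = blockEval (fun p => ∑ q, P p q * R q) γ := by
  ext p q i j
  simp [Matrix.mul_apply, blockEval, Matrix.sum_apply]

theorem blockDet_blockEval_append {ι : Type} {a k n : ℕ}
    (P : Matrix (Fin (a + k)) (Fin (a + k)) (Matrix (Fin n) (Fin n) ℂ))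
    (R : Fin (a + k) → Matrix (Fin n) ι ℂ) (W : Fin a → Matrix (Fin n) ι ℂ)
    (Z : Fin k → Matrix (Fin n) ι ℂ) (γ : Fin a → Fin n → ι) (δ : Fin k → Fin n → ι)
    (hPR : ∀ p, ∑ q, P p q * R q = Fin.append W Z p)
    (hW : blockEval W δ = 0) (hZ : blockEval Z δ = 1) :
    blockDet P * blockDet (blockEval R (Fin.append γ δ)) = blockDet (blockEval W γ) := by
  rw [← blockDet_mul, mul_blockEval, funext hPR, blockDet_of_upperRight_eq_zero]
  · have h1 : (blockEval (Fin.append W Z) (Fin.append γ δ)).submatrix (Fin.castAdd k)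
        (Fin.castAdd k) = blockEval W γ := by
      ext; simp [blockEval]
    have h2 : (blockEval (Fin.append W Z) (Fin.append γ δ)).submatrix (Fin.natAdd a)
        (Fin.natAdd a) = blockEval Z δ := by
      ext; simp [blockEval]
    rw [h1, h2, hZ, blockDet, blockDet, Matrix.comp_one, Matrix.det_one, mul_one]
  · intro i j
    have := congrFun (congrFun hW i) j
    simpa [blockEval] using this

/-- The concatenation of `b` blocks of length `n`. -/
def blockList {α : Type} {b n : ℕ} (f : Fin b → Fin n → α) : List α :=
  (List.ofFn fun p => List.ofFn (f p)).flatten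

theorem blockList_append {α : Type} {a b n : ℕ} (f : Fin a → Fin n → α) (g : Fin b → Fin n → α) :
    blockList f ++ blockList g = blockList (Fin.append f g) := by
  have h : (fun p => List.ofFn (Fin.append f g p)) =
      Fin.append (fun p => List.ofFn (f p)) (fun p => List.ofFn (g p)) := by
    funext p
    refine Fin.addCases (fun i => ?_) (fun i => ?_) p <;> simp
  rw [blockList, blockList, blockList, h, List.ofFn_fin_append, List.flatten_append]

theorem ofFn_eq_blockList {α : Type} {b n : ℕ} (f : Fin (b * n) → α) :
    List.ofFn f = blockList fun p i => f (finProdFinEquiv (p, i)) := by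
  rw [List.ofFn_mul, blockList]
  congr
  funext p
  congr
  funext i
  congr 1
  ext
  simp [mul_comm, add_comm]

theorem exists_eq_blockList {α : Type} {b n : ℕ} {l : List α} (h : l.length = b * n) :
    ∃ f : Fin b → Fin n → α, l = blockList f := by
  refine ⟨_, .trans ?_ (ofFn_eq_blockList fun k => l.get (k.cast h.symm))⟩
  apply List.ext_getElem <;> simp [h]

theorem length_blockList {α : Type} {b n : ℕ} (f : Fin b → Fin n → α) :
    (blockList f).length = b * n := by
  simp [blockList, List.length_flatten, List.map_ofFn, Function.comp_def, List.ofFn_const]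

theorem minorDet_ofFn {κ : Type} {r : ℕ} (V : Fin r → κ → ℂ) (c : Fin r → κ) :
    minorDet (List.ofFn V) (List.ofFn c) = (Matrix.of fun i j => V i (c j)).det := by
  rw [minorDet, if_pos (by simp),
    ← Matrix.det_submatrix_equiv_self (finCongr (List.length_ofFn (f := V)))]
  congr 1
  ext i j
  have hj : (j : ℕ) < r := by simpa using j.2
  simp [hj]
  rfl

theorem minorDet_blockList {κ : Type} {b n : ℕ} (R : Fin b → Matrix (Fin n) κ ℂ)
    (γ : Fin b → Fin n → κ) :
    minorDet (blockList R) (blockList γ) = blockDet (blockEval R γ) := by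
  have h : ∀ {α : Type} (f : Fin b → Fin n → α), blockList f =
      List.ofFn fun k => f (finProdFinEquiv.symm k).1 (finProdFinEquiv.symm k).2 := fun f => by
    rw [ofFn_eq_blockList]; simp
  rw [h γ, h (α := κ → ℂ) R, minorDet_ofFn, blockDet,
    ← Matrix.det_submatrix_equiv_self finProdFinEquiv]
  congr 1
  ext ⟨p, i⟩ ⟨q, j⟩
  simp only [Matrix.submatrix_apply, Matrix.of_apply, Equiv.symm_apply_apply, Matrix.comp_apply,
    blockEval, id]

end Grassmann

/-! ### Tetrahedron weights -/

theorem ofBlocks_finProdFinEquiv {b c n : ℕ} (B : Fin b → Fin c → Matrix (Fin n) (Fin n) ℂ)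
    (p : Fin b) (q : Fin c) (i j : Fin n) :
    ofBlocks B (finProdFinEquiv (p, i)) (finProdFinEquiv (q, j)) = B p q i j := by
  have hn : 0 < n := i.pos
  simp only [ofBlocks, Matrix.of_apply, finProdFinEquiv_apply_val, Nat.add_mul_div_left _ _ hn,
    Nat.add_mul_mod_self_left, Nat.div_eq_of_lt i.2, Nat.div_eq_of_lt j.2, Nat.mod_eq_of_lt i.2,
    Nat.mod_eq_of_lt j.2, zero_add]

theorem tetraCol_finProdFinEquiv {n : ℕ} (i₁ i₂ i₃ i₄ : Fin 5) (q : Fin 4) (j : Fin n) :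
    tetraCol i₁ i₂ i₃ i₄ (finProdFinEquiv (q, j)) =
      fc (tetraFaces i₁ i₂ i₃ i₄ q).1 (tetraFaces i₁ i₂ i₃ i₄ q).2.1
        (tetraFaces i₁ i₂ i₃ i₄ q).2.2 j := by
  have hn : 0 < n := j.pos
  simp only [tetraCol, finProdFinEquiv_apply_val, Nat.add_mul_div_left _ _ hn,
    Nat.add_mul_mod_self_left, Nat.div_eq_of_lt j.2, Nat.mod_eq_of_lt j.2, zero_add]

theorem tetraCol_strictMono {n : ℕ} {i₁ i₂ i₃ i₄ : Fin 5} (h₁₂ : i₁ < i₂) (h₂₃ : i₂ < i₃)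
    (h₃₄ : i₃ < i₄) : StrictMono (tetraCol (n := n) i₁ i₂ i₃ i₄) := by
  have hface : StrictMono fun q => (toLex ((tetraFaces i₁ i₂ i₃ i₄ q).1,
      toLex ((tetraFaces i₁ i₂ i₃ i₄ q).2.1, (tetraFaces i₁ i₂ i₃ i₄ q).2.2)) :
        Fin 5 ×ₗ Fin 5 ×ₗ Fin 5) := by
    rw [Fin.strictMono_iff_lt_succ]
    intro q
    fin_cases q <;> simp [tetraFaces, Prod.Lex.toLex_lt_toLex, h₁₂, h₂₃, h₃₄]
  intro k l hkl
  obtain ⟨⟨p, i⟩, rfl⟩ := finProdFinEquiv.surjective k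
  obtain ⟨⟨q, j⟩, rfl⟩ := finProdFinEquiv.surjective l
  rw [tetraCol_finProdFinEquiv, tetraCol_finProdFinEquiv]
  rw [Fin.lt_def, finProdFinEquiv_apply_val, finProdFinEquiv_apply_val] at hkl
  simp only at hkl
  unfold fc
  rw [Prod.Lex.toLex_lt_toLex]
  rcases lt_trichotomy p q with h | rfl | h
  · exact Or.inl (hface h)
  · exact Or.inr ⟨rfl, by simpa using hkl⟩
  · exfalso
    have h' : (q : ℕ) + 1 ≤ p := h
    have hn := Nat.mul_le_mul_left n h'
    have hj := j.2
    rw [Nat.mul_add] at hn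
    omega

/-- The generator vector `a_{ijk}` as a block row. -/
def faceRow (n : ℕ) (i j k : Fin 5) : Matrix (Fin n) (FaceComp n) ℂ :=
  Matrix.of fun c s => if fc i j k c = s then 1 else 0

theorem faceRow_submatrix_self (n : ℕ) (i j k : Fin 5) :
    (faceRow n i j k).submatrix id (fc i j k) = 1 := by
  ext c d
  simp [faceRow, fc, Matrix.one_apply]

theorem faceRow_submatrix_of_ne (n : ℕ) {i j k i' j' k' : Fin 5} (h : (i, j, k) ≠ (i', j', k')) :
    (faceRow n i j k).submatrix id (fc i' j' k') = 0 := by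
  ext c d
  refine if_neg fun he => h ?_
  simp only [fc, id, EmbeddingLike.apply_eq_iff_eq, Prod.mk.injEq] at he
  simp [he.1]

/-- The block rows of the matrix `f₃^full` of a tetrahedron. -/
noncomputable def tetraRows {n : ℕ} (ζ : Fin 5 → Matrix (Fin n) (Fin n) ℂ)
    (i₁ i₂ i₃ i₄ : Fin 5) : Fin 2 → Matrix (Fin n) (FaceComp n) ℂ :=
  ![faceRow n i₁ i₂ i₃ - faceRow n i₁ i₂ i₄ + faceRow n i₁ i₃ i₄,
    (ζ i₂ - ζ i₃)⁻¹ * (ζ i₃ - ζ i₁) * faceRow n i₁ i₂ i₃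
      - (ζ i₂ - ζ i₄)⁻¹ * (ζ i₄ - ζ i₁) * faceRow n i₁ i₂ i₄ - faceRow n i₂ i₃ i₄]

theorem tetraWeight_eq_linProd {n : ℕ} (ζ : Fin 5 → Matrix (Fin n) (Fin n) ℂ)
    {i₁ i₂ i₃ i₄ : Fin 5} (h₁₂ : i₁ < i₂) (h₂₃ : i₂ < i₃) (h₃₄ : i₃ < i₄) :
    tetraWeight ζ i₁ i₂ i₃ i₄ = linProd (blockList (tetraRows ζ i₁ i₂ i₃ i₄)) := by
  have hrows : (fun p i => rowForm (ofBlocks (tetraBlocks ζ i₁ i₂ i₃ i₄))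
      (tetraCol i₁ i₂ i₃ i₄) (finProdFinEquiv (p, i))) = tetraRows ζ i₁ i₂ i₃ i₄ := by
    funext p i s
    have hsum : rowForm (ofBlocks (tetraBlocks ζ i₁ i₂ i₃ i₄)) (tetraCol i₁ i₂ i₃ i₄)
        (finProdFinEquiv (p, i)) s =
        ∑ q, (tetraBlocks ζ i₁ i₂ i₃ i₄ p q * faceRow n (tetraFaces i₁ i₂ i₃ i₄ q).1
          (tetraFaces i₁ i₂ i₃ i₄ q).2.1 (tetraFaces i₁ i₂ i₃ i₄ q).2.2) i s := by
      rw [rowForm, ← finProdFinEquiv.sum_comp, Fintype.sum_prod_type]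
      simp only [ofBlocks_finProdFinEquiv, tetraCol_finProdFinEquiv, Matrix.mul_apply, faceRow,
        Matrix.of_apply, mul_ite, mul_one, mul_zero]
    rw [hsum, Fin.sum_univ_four]
    fin_cases p
    · simp [tetraBlocks, tetraRows, tetraFaces, sub_eq_add_neg]
    · simp [tetraBlocks, tetraRows, tetraFaces, sub_eq_add_neg]
  rw [tetraWeight, genFunL_eq_linProd _ (tetraCol_strictMono h₁₂ h₂₃ h₃₄), ofFn_eq_blockList, hrows]

theorem Da_eq_ofFn (n : ℕ) (i j k : Fin 5) : Da n i j k = List.ofFn (fc i j k) := by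
  rw [Da, List.ofFn_eq_map]

/-! ### Elimination of the integrated generators -/

/-- The block rows left after eliminating the generators `a_{123}` from the stacked matrices of
the tetrahedra `1234` and `1235`. -/
noncomputable def reducedRows {n : ℕ} (ζ : Fin 5 → Matrix (Fin n) (Fin n) ℂ) :
    Fin 3 → Matrix (Fin n) (FaceComp n) ℂ :=
  ![(ζ 1 - ζ 2)⁻¹ * (ζ 2 - ζ 0) * (faceRow n 0 2 3 - faceRow n 0 1 3)
      + (ζ 1 - ζ 3)⁻¹ * (ζ 3 - ζ 0) * faceRow n 0 1 3 + faceRow n 1 2 3,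
    faceRow n 0 2 3 - faceRow n 0 1 3 + faceRow n 0 1 4 - faceRow n 0 2 4,
    (ζ 1 - ζ 4)⁻¹ * (ζ 4 - ζ 0) * faceRow n 0 1 4 - (ζ 1 - ζ 3)⁻¹ * (ζ 3 - ζ 0) * faceRow n 0 1 3
      + faceRow n 1 2 4 - faceRow n 1 2 3]

theorem diagonal_neg_one {n : ℕ} :
    (Matrix.diagonal fun _ => -1 : Matrix (Fin n) (Fin n) ℂ) = -1 := by
  rw [← Matrix.diagonal_one, Matrix.diagonal_neg]

theorem mul_submatrix_id {κ : Type} {n : ℕ} (A : Matrix (Fin n) (Fin n) ℂ)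
    (B : Matrix (Fin n) κ ℂ) (γ : Fin n → κ) :
    (A * B).submatrix id γ = A * B.submatrix id γ := rfl

theorem blockDet_left {n : ℕ} (ζ : Fin 5 → Matrix (Fin n) (Fin n) ℂ)
    (γ : Fin 3 → Fin n → FaceComp n) :
    blockDet (blockEval (Fin.append (tetraRows ζ 0 1 2 3) (tetraRows ζ 0 1 2 4))
      (Fin.append (m := 3) (n := 1) γ ![fc 0 1 2])) = blockDet (blockEval (reducedRows ζ) γ) := by
  let S : Matrix (Fin (3 + 1)) (Fin (3 + 1)) ℂ :=
    !![0, -1, 0, 0; 1, 0, -1, 0; 0, 1, 0, -1; 1, 0, 0, 0]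
  let X : Matrix (Fin n) (Fin n) ℂ := (ζ 1 - ζ 2)⁻¹ * (ζ 2 - ζ 0)
  let T : Matrix (Fin (3 + 1)) (Fin (3 + 1)) (Matrix (Fin n) (Fin n) ℂ) :=
    !![1, 0, 0, X; 0, 1, 0, 0; 0, 0, 1, 0; 0, 0, 0, 1]
  have hS : S.det = 1 := by
    simp [S, Matrix.det_succ_row_zero, Fin.sum_univ_succ, Fin.succAbove]
  have hT : blockDet T = 1 := by
    rw [blockDet_of_upperTriangular]
    · simp [T, Fin.prod_univ_succ]
    · intro i j hij
      fin_cases i <;> fin_cases j <;> first | rfl | (exact absurd hij (by decide))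
  have hP : blockDet (T * S.map (Matrix.scalar (Fin n))) = 1 := by
    rw [blockDet_mul, blockDet_map_scalar, hS, hT, one_pow, one_mul]
  have hrows : Fin.append (tetraRows ζ 0 1 2 3) (tetraRows ζ 0 1 2 4) =
      ![tetraRows ζ 0 1 2 3 0, tetraRows ζ 0 1 2 3 1,
        tetraRows ζ 0 1 2 4 0, tetraRows ζ 0 1 2 4 1] := by
    funext p
    fin_cases p <;> rfl
  rw [← blockDet_blockEval_append (T * S.map (Matrix.scalar (Fin n))) _ (reducedRows ζ)
    ![tetraRows ζ 0 1 2 3 0] γ ![fc 0 1 2], hP, one_mul]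
  · intro p
    rw [hrows]
    fin_cases p
    · change _ = reducedRows ζ 0
      simp [T, S, X, Matrix.mul_apply, Fin.sum_univ_succ, reducedRows, tetraRows, diagonal_neg_one,
        Matrix.mul_add, Matrix.mul_sub]
      abel
    · change _ = reducedRows ζ 1
      simp [T, S, Matrix.mul_apply, Fin.sum_univ_succ, reducedRows, tetraRows, diagonal_neg_one]
      abel
    · change _ = reducedRows ζ 2
      simp [T, S, Matrix.mul_apply, Fin.sum_univ_succ, reducedRows, tetraRows, diagonal_neg_one]
      abel
    · change _ = tetraRows ζ 0 1 2 3 0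
      simp [T, S, Matrix.mul_apply, Fin.sum_univ_succ, tetraRows]
  · ext1 p q
    fin_cases p <;> fin_cases q <;>
      simp [blockEval, reducedRows, Matrix.submatrix_add, Matrix.submatrix_sub, mul_submatrix_id,
        faceRow_submatrix_of_ne]
  · ext1 p q
    fin_cases p
    fin_cases q
    simp [blockEval, tetraRows, Matrix.submatrix_add, Matrix.submatrix_sub,
      faceRow_submatrix_of_ne, faceRow_submatrix_self]

theorem inv_mul_sub_inv_mul {n : ℕ} {x y z : Matrix (Fin n) (Fin n) ℂ} (hxy : IsUnit (x - y))
    (hxz : IsUnit (x - z)) (w : Matrix (Fin n) (Fin n) ℂ) :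
    (x - z)⁻¹ * (z - w) - (x - y)⁻¹ * (y - w) =
      (x - z)⁻¹ * (y - z) * (x - y)⁻¹ * (w - x) := by
  rw [Matrix.isUnit_iff_isUnit_det] at hxy hxz
  have h₁ : z - w = (x - w) - (x - z) := by abel
  have h₂ : y - w = (x - w) - (x - y) := by abel
  have h₃ : y - z = (x - z) - (x - y) := by abel
  have h₄ : w - x = -(x - w) := by abel
  rw [h₁, h₂, h₃, h₄]
  generalize x - w = c
  generalize x - z = a at *
  generalize x - y = b at *
  rw [mul_sub, mul_sub, mul_sub, Matrix.nonsing_inv_mul _ hxz, Matrix.nonsing_inv_mul _ hxy,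
    sub_mul, sub_mul, one_mul, Matrix.mul_assoc a⁻¹, Matrix.mul_nonsing_inv _ hxy]
  noncomm_ring

theorem blockDet_right {n : ℕ} (ζ : Fin 5 → Matrix (Fin n) (Fin n) ℂ)
    (hζ : ∀ i j : Fin 5, i ≠ j → IsUnit (ζ i - ζ j)) (γ : Fin 3 → Fin n → FaceComp n) :
    blockDet (blockEval (Fin.append (Fin.append (tetraRows ζ 0 1 3 4) (tetraRows ζ 1 2 3 4))
        (tetraRows ζ 0 2 3 4)) (Fin.append (m := 3) (n := 3) γ ![fc 0 3 4, fc 1 3 4, fc 2 3 4])) =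
      ((ζ 2 - ζ 4)⁻¹ * (ζ 3 - ζ 4) * (ζ 2 - ζ 3)⁻¹ * (ζ 1 - ζ 2)).det *
        blockDet (blockEval (reducedRows ζ) γ) := by
  let S : Matrix (Fin (3 + 3)) (Fin (3 + 3)) ℂ :=
    !![0, 0, 0, -1, 0, 1; 1, 0, 0, 0, -1, 0; 0, 1, 1, 0, 0, 0;
      1, 0, 0, 0, 0, 0; 0, -1, 0, 0, 0, 0; 0, 0, 0, -1, 0, 0]
  let P : Matrix (Fin n) (Fin n) ℂ := (ζ 2 - ζ 3)⁻¹ * (ζ 3 - ζ 1)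
  let Q : Matrix (Fin n) (Fin n) ℂ := (ζ 2 - ζ 4)⁻¹ * (ζ 4 - ζ 1)
  let U : Matrix (Fin n) (Fin n) ℂ := (ζ 2 - ζ 3)⁻¹ * (ζ 3 - ζ 0)
  let V : Matrix (Fin n) (Fin n) ℂ := (ζ 2 - ζ 4)⁻¹ * (ζ 4 - ζ 0)
  let X : Matrix (Fin n) (Fin n) ℂ := (ζ 1 - ζ 2)⁻¹ * (ζ 2 - ζ 0)
  let Y : Matrix (Fin n) (Fin n) ℂ := (ζ 1 - ζ 3)⁻¹ * (ζ 3 - ζ 0)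
  let Z : Matrix (Fin n) (Fin n) ℂ := (ζ 1 - ζ 4)⁻¹ * (ζ 4 - ζ 0)
  let K : Matrix (Fin 3) (Fin 3) (Matrix (Fin n) (Fin n) ℂ) :=
    !![Q - P, V, Q; 0, -1, 0; 0, 0, -1]
  have hcancel : ∀ i j, i ≠ j → (ζ i - ζ j) * (ζ i - ζ j)⁻¹ = 1 := fun i j hij =>
    Matrix.mul_nonsing_inv _ ((Matrix.isUnit_iff_isUnit_det _).1 (hζ i j hij))
  have hcancel' : ∀ i j, i ≠ j → (ζ j - ζ i) * (ζ i - ζ j)⁻¹ = -1 := fun i j hij => by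
    rw [← neg_sub, neg_mul, hcancel i j hij]
  have hQP : Q - P = (ζ 2 - ζ 4)⁻¹ * (ζ 3 - ζ 4) * (ζ 2 - ζ 3)⁻¹ * (ζ 1 - ζ 2) :=
    inv_mul_sub_inv_mul (hζ 2 3 (by decide)) (hζ 2 4 (by decide)) _
  have hUV : (Q - P) * X = U - V := by
    have h := inv_mul_sub_inv_mul (hζ 2 3 (by decide)) (hζ 2 4 (by decide)) (ζ 0)
    rw [hQP, ← neg_sub V U, show V - U = _ from h]
    simp only [X]
    rw [← neg_sub (ζ 2) (ζ 0), mul_neg, neg_neg, ← Matrix.mul_assoc, Matrix.mul_assoc _ (ζ 1 - ζ 2),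
      hcancel 1 2 (by decide), Matrix.mul_one]
  have hPY : P * Y = -U := by
    simp only [P, Y, U]
    rw [← Matrix.mul_assoc, Matrix.mul_assoc _ (ζ 3 - ζ 1), hcancel' 1 3 (by decide)]
    simp
  have hQZ : Q * Z = -V := by
    simp only [Q, Z, V]
    rw [← Matrix.mul_assoc, Matrix.mul_assoc _ (ζ 4 - ζ 1), hcancel' 1 4 (by decide)]
    simp
  have hS : S.det = 1 := by
    simp [S, Matrix.det_succ_row_zero, Fin.sum_univ_succ, Fin.succAbove]
    norm_num
  have hP : blockDet (S.map (Matrix.scalar (Fin n))) = 1 := by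
    rw [blockDet_map_scalar, hS, one_pow]
  have hK : blockDet K = (Q - P).det := by
    rw [blockDet_of_upperTriangular]
    · simp [K, Fin.prod_univ_succ, Matrix.det_neg, ← mul_pow]
    · intro i j hij
      fin_cases i <;> fin_cases j <;> first | rfl | (exact absurd hij (by decide))
  have hrows : Fin.append (Fin.append (tetraRows ζ 0 1 3 4) (tetraRows ζ 1 2 3 4))
      (tetraRows ζ 0 2 3 4) = ![tetraRows ζ 0 1 3 4 0, tetraRows ζ 0 1 3 4 1,
        tetraRows ζ 1 2 3 4 0, tetraRows ζ 1 2 3 4 1,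
        tetraRows ζ 0 2 3 4 0, tetraRows ζ 0 2 3 4 1] := by
    funext p
    fin_cases p <;> rfl
  have hW : (fun p => ∑ q, K p q * reducedRows ζ q) =
      ![tetraRows ζ 0 2 3 4 1 - tetraRows ζ 1 2 3 4 1,
        tetraRows ζ 0 1 3 4 0 - tetraRows ζ 0 2 3 4 0,
        tetraRows ζ 0 1 3 4 1 + tetraRows ζ 1 2 3 4 0] := by
    funext p
    fin_cases p
    · have e₀ : reducedRows ζ 0 = X * (faceRow n 0 2 3 - faceRow n 0 1 3) + Y * faceRow n 0 1 3
        + faceRow n 1 2 3 := rfl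
      have e₂ : reducedRows ζ 2 = Z * faceRow n 0 1 4 - Y * faceRow n 0 1 3 + faceRow n 1 2 4
        - faceRow n 1 2 3 := rfl
      have e₃ : tetraRows ζ 0 2 3 4 1 - tetraRows ζ 1 2 3 4 1 =
        (U * faceRow n 0 2 3 - V * faceRow n 0 2 4 - faceRow n 2 3 4) -
          (P * faceRow n 1 2 3 - Q * faceRow n 1 2 4 - faceRow n 2 3 4) := rfl
      change ∑ q, K 0 q * reducedRows ζ q = tetraRows ζ 0 2 3 4 1 - tetraRows ζ 1 2 3 4 1
      rw [Fin.sum_univ_three, e₀, e₂, e₃]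
      change (Q - P) * _ + V * (faceRow n 0 2 3 - faceRow n 0 1 3 + faceRow n 0 1 4
        - faceRow n 0 2 4) + Q * _ = _
      simp only [Matrix.mul_add, Matrix.mul_sub, ← Matrix.mul_assoc, hUV, hQZ]
      simp only [Matrix.sub_mul, hPY, Matrix.neg_mul]
      abel
    · simp [K, Fin.sum_univ_succ, reducedRows, tetraRows]
      abel
    · simp [K, Fin.sum_univ_succ, reducedRows, tetraRows]
      abel
  rw [← hQP, ← hK, ← blockDet_mul, mul_blockEval, hW]
  rw [← blockDet_blockEval_append (S.map (Matrix.scalar (Fin n))) _ _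
    ![tetraRows ζ 0 1 3 4 0, -tetraRows ζ 0 1 3 4 1, -tetraRows ζ 1 2 3 4 1] γ
    ![fc 0 3 4, fc 1 3 4, fc 2 3 4], hP, one_mul]
  · intro p
    rw [hrows]
    fin_cases p
    · change _ = tetraRows ζ 0 2 3 4 1 - tetraRows ζ 1 2 3 4 1
      simp [S, Fin.sum_univ_succ, diagonal_neg_one]
      abel
    · change _ = tetraRows ζ 0 1 3 4 0 - tetraRows ζ 0 2 3 4 0
      simp [S, Fin.sum_univ_succ, diagonal_neg_one]
      abel
    · change _ = tetraRows ζ 0 1 3 4 1 + tetraRows ζ 1 2 3 4 0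
      simp [S, Fin.sum_univ_succ]
    · change _ = tetraRows ζ 0 1 3 4 0
      simp [S, Fin.sum_univ_succ]
    · change _ = -tetraRows ζ 0 1 3 4 1
      simp [S, Fin.sum_univ_succ, diagonal_neg_one]
    · change _ = -tetraRows ζ 1 2 3 4 1
      simp [S, Fin.sum_univ_succ, diagonal_neg_one]
  · ext1 p q
    fin_cases p <;> fin_cases q <;>
      simp [blockEval, tetraRows, Matrix.submatrix_add, Matrix.submatrix_sub, mul_submatrix_id,
        faceRow_submatrix_of_ne]
  · ext1 p q
    fin_cases p <;> fin_cases q <;>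
      simp [blockEval, tetraRows, Matrix.submatrix_add, Matrix.submatrix_sub,
        mul_submatrix_id, faceRow_submatrix_of_ne, faceRow_submatrix_self]

/-- **The matrix pentagon equation** (Theorem 3 of the paper): for `n×n` matrix
coordinates `ζ_1, …, ζ_5` (here indexed by `0, …, 4 : Fin 5`) with all pairwise
differences invertible,
`(det ζ_{23} / (det ζ_{34} · det ζ_{35})) ∫⋯∫ 𝐟_{1234} 𝐟_{1235} 𝒟a_{123}
  = (det ζ_{45})⁻¹ ∫⋯∫ 𝐟_{1245} 𝐟_{2345} 𝐟_{1345} 𝒟a_{145} 𝒟a_{245} 𝒟a_{345}`. -/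
theorem matrix_pentagon (n : ℕ) (ζ : Fin 5 → Matrix (Fin n) (Fin n) ℂ)
    (hζ : ∀ i j : Fin 5, i ≠ j → IsUnit (ζ i - ζ j)) :
    ((ζ 1 - ζ 2).det / ((ζ 2 - ζ 3).det * (ζ 2 - ζ 4).det)) •
        multiBerezin (Da n 0 1 2)
          (gmul (tetraWeight ζ 0 1 2 3) (tetraWeight ζ 0 1 2 4))
      = ((ζ 3 - ζ 4).det)⁻¹ •
        multiBerezin (Da n 0 3 4 ++ Da n 1 3 4 ++ Da n 2 3 4)
          (gmul (gmul (tetraWeight ζ 0 1 3 4) (tetraWeight ζ 1 2 3 4))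
            (tetraWeight ζ 0 2 3 4)) := by
  funext T
  have hL : gmul (tetraWeight ζ 0 1 2 3) (tetraWeight ζ 0 1 2 4) =
      linProd (blockList (Fin.append (tetraRows ζ 0 1 2 3) (tetraRows ζ 0 1 2 4))) := by
    rw [tetraWeight_eq_linProd ζ (by decide) (by decide) (by decide),
      tetraWeight_eq_linProd ζ (by decide) (by decide) (by decide), ← linProd_append]
    exact congrArg linProd (blockList_append _ _)
  have hR : gmul (gmul (tetraWeight ζ 0 1 3 4) (tetraWeight ζ 1 2 3 4)) (tetraWeight ζ 0 2 3 4) =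
      linProd (blockList (Fin.append (Fin.append (tetraRows ζ 0 1 3 4) (tetraRows ζ 1 2 3 4))
        (tetraRows ζ 0 2 3 4))) := by
    rw [tetraWeight_eq_linProd ζ (by decide) (by decide) (by decide),
      tetraWeight_eq_linProd ζ (by decide) (by decide) (by decide),
      tetraWeight_eq_linProd ζ (by decide) (by decide) (by decide), ← linProd_append,
      ← linProd_append]
    exact congrArg linProd ((congrArg (· ++ _) (blockList_append _ _)).trans (blockList_append _ _))
  have hDL : Da n 0 1 2 = blockList ![fc 0 1 2] := by
    simp [blockList, Da_eq_ofFn]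
  have hDR : Da n 0 3 4 ++ Da n 1 3 4 ++ Da n 2 3 4 =
      blockList ![fc 0 3 4, fc 1 3 4, fc 2 3 4] := by
    simp [blockList, Da_eq_ofFn]
  rw [Pi.smul_apply, Pi.smul_apply, hL, hR, hDL, hDR, multiBerezin_linProd, multiBerezin_linProd]
  by_cases hT : T.sort.length = 3 * n
  · obtain ⟨γ, hγ⟩ := exists_eq_blockList hT
    rw [hγ, blockList_append, blockList_append]
    have h₁ := (minorDet_blockList (Fin.append (tetraRows ζ 0 1 2 3) (tetraRows ζ 0 1 2 4))
      (Fin.append (m := 3) (n := 1) γ ![fc 0 1 2])).trans (blockDet_left ζ γ)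
    have h₂ := (minorDet_blockList (Fin.append (Fin.append (tetraRows ζ 0 1 3 4)
      (tetraRows ζ 1 2 3 4)) (tetraRows ζ 0 2 3 4)) (Fin.append (m := 3) (n := 3) γ
        ![fc 0 3 4, fc 1 3 4, fc 2 3 4])).trans (blockDet_right ζ hζ γ)
    have hdet : ∀ i j, i ≠ j → (ζ i - ζ j).det ≠ 0 := fun i j hij =>
      ((Matrix.isUnit_iff_isUnit_det _).1 (hζ i j hij)).ne_zero
    have h34 := hdet 3 4 (by decide)
    refine (congrArg _ h₁).trans (.trans ?_ (congrArg _ h₂).symm)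
    simp only [smul_eq_mul, Matrix.det_mul, Matrix.det_nonsing_inv, Ring.inverse_eq_inv']
    field_simp
  · rw [minorDet_of_length_ne, minorDet_of_length_ne, smul_zero, smul_zero]
    · rw [List.length_append, length_blockList]
      refine fun h => hT ?_
      rw [length_blockList (n := n)] at h
      omega
    · rw [List.length_append, length_blockList]
      refine fun h => hT ?_
      rw [length_blockList (n := n)] at h
      omega
end
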